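/- Let q : [0,T] → ℝⁿ be continuous and nonvanishing with ∫₀ᵀ ‖q(t)‖² dt = 1, let G_i(q) = ∫₀ᵀ q_i‖q‖ dt be the closure constraint functionals, and let b_j = (q_j/‖q‖)q + ‖q‖e_j be the associated normal-space basis functions. Then the Jacobian of the constraints along these directions is DG_i(q)[b_j] = δ_{ij} + 3∫₀ᵀ q_i(t)q_j(t) dt, where δ_{ij} is the Kronecker delta. -/

import Mathlib

open Set

/-- The derivative at `ε = 0` of `(x + ε v)_i ‖x + ε v‖`, at a point `x ≠ 0`. -/
lemma EuclideanSpace.hasDerivAt_apply_mul_norm {ι : Type*} [Fintype ι]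
    {x : EuclideanSpace ℝ ι} (hx : x ≠ 0) (v : EuclideanSpace ℝ ι) (i : ι) :
    HasDerivAt (fun ε : ℝ => (x + ε • v) i * ‖x + ε • v‖)
      (v i * ‖x‖ + x i * (inner ℝ x v / ‖x‖)) 0 := by
  have hline : HasDerivAt (fun ε : ℝ => x + ε • v) v 0 := by
    simpa using ((hasDerivAt_id (0 : ℝ)).smul_const v).const_add x
  have hcoord : HasDerivAt (fun ε : ℝ => (x + ε • v) i) (v i) 0 := by
    simpa using ((hasDerivAt_id (0 : ℝ)).mul_const (v i)).const_add (x i)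
  have hnorm : HasDerivAt (fun ε : ℝ => ‖x + ε • v‖) (inner ℝ x v / ‖x‖) 0 := by
    have h := hline.norm_sq.sqrt (by simpa using hx)
    simp only [Real.sqrt_sq (norm_nonneg _), zero_smul, add_zero] at h
    convert h using 1
    field_simp
  exact (hcoord.fun_mul hnorm).congr_deriv (by simp)

/-- The map `x ↦ x_i ‖x‖` is Lipschitz on bounded sets. -/
lemma EuclideanSpace.abs_apply_mul_norm_sub_le {ι : Type*} [Fintype ι]
    (x y : EuclideanSpace ℝ ι) (i : ι) :
    |x i * ‖x‖ - y i * ‖y‖| ≤ (‖x‖ + ‖y‖) * ‖x - y‖ := by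
  have h1 : |x i - y i| ≤ ‖x - y‖ := by simpa using PiLp.norm_apply_le (x - y) i
  have h2 : |y i| ≤ ‖y‖ := PiLp.norm_apply_le y i
  calc |x i * ‖x‖ - y i * ‖y‖| = |(x i - y i) * ‖x‖ + y i * (‖x‖ - ‖y‖)| := by ring_nf
    _ ≤ |x i - y i| * ‖x‖ + |y i| * |‖x‖ - ‖y‖| := by
      refine (abs_add_le _ _).trans_eq ?_
      rw [abs_mul, abs_mul, abs_norm]
    _ ≤ ‖x - y‖ * ‖x‖ + ‖y‖ * ‖x - y‖ := by
      gcongr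
      exact abs_norm_sub_norm_le x y
    _ = (‖x‖ + ‖y‖) * ‖x - y‖ := by ring

/-- For a nonvanishing continuous `q : [0,T] → ℝⁿ` of unit `L²` norm, the Jacobian of
the closure constraint functionals `G_i(q) = ∫₀ᵀ q_i‖q‖ dt` along the normal-space
basis directions `b_j = (q_j/‖q‖)q + ‖q‖e_j` is
`DG_i(q)[b_j] = δ_{ij} + 3∫₀ᵀ q_i q_j dt`. -/
theorem closure_constraint_jacobian (n : ℕ) (T : ℝ) (hT : 0 < T)
    (q : ℝ → EuclideanSpace ℝ (Fin n)) (hq : Continuous q)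
    (hne : ∀ t ∈ Icc (0:ℝ) T, q t ≠ 0)
    (hunit : (∫ t in (0:ℝ)..T, ‖q t‖ ^ 2) = 1)
    (b : Fin n → ℝ → EuclideanSpace ℝ (Fin n))
    (hb : ∀ j t, b j t = (q t j / ‖q t‖) • q t + ‖q t‖ • (EuclideanSpace.single j (1:ℝ))) :
    ∀ i j : Fin n,
      HasDerivAt (fun ε : ℝ => ∫ t in (0:ℝ)..T, (q t + ε • b j t) i * ‖q t + ε • b j t‖)
        ((if i = j then (1:ℝ) else 0) + 3 * ∫ t in (0:ℝ)..T, q t i * q t j) 0 := by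
  intro i j
  have hqc (k : Fin n) : Continuous fun t => q t k := by fun_prop
  have hbm : Measurable (b j) := by
    have hqm : Measurable q := hq.measurable
    have hqk : Measurable fun t => q t j := (hqc j).measurable
    rw [funext (hb j)]
    fun_prop
  have hFm (ε : ℝ) : Measurable fun t => (q t + ε • b j t) i * ‖q t + ε • b j t‖ := by
    have hv : Measurable fun t => q t + ε • b j t := hq.measurable.add (hbm.const_smul ε)
    have hvi : Measurable fun t => (q t + ε • b j t) i :=
      (EuclideanSpace.proj i : EuclideanSpace ℝ (Fin n) →L[ℝ] ℝ).continuous.measurable.comp hv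
    exact hvi.mul hv.norm
  have hbn (t : ℝ) : ‖b j t‖ ≤ 2 * ‖q t‖ := by
    have hle : |q t j| ≤ ‖q t‖ := PiLp.norm_apply_le (q t) j
    rw [hb]
    refine (norm_add_le _ _).trans ?_
    rw [norm_smul, norm_smul, norm_div, norm_norm, Real.norm_eq_abs, PiLp.norm_single,
      norm_one, mul_one, two_mul]
    gcongr
    exact mul_le_of_le_one_left (norm_nonneg _) (div_le_one_of_le₀ hle (norm_nonneg _))
  have hval : (∫ t in (0:ℝ)..T, ((if i = j then (1:ℝ) else 0) * ‖q t‖ ^ 2 + 3 * (q t i * q t j)))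
      = (if i = j then (1:ℝ) else 0) + 3 * ∫ t in (0:ℝ)..T, q t i * q t j := by
    rw [intervalIntegral.integral_add
      (Continuous.intervalIntegrable (by fun_prop) _ _)
      (Continuous.intervalIntegrable (by fun_prop) _ _),
      intervalIntegral.integral_const_mul, intervalIntegral.integral_const_mul, hunit, mul_one]
  rw [← hval]
  refine (intervalIntegral.hasDerivAt_integral_of_dominated_loc_of_lip
    (bound := fun t => 12 * ‖q t‖ ^ 2) (Metric.ball_mem_nhds 0 one_pos)
    (.of_forall fun ε => (hFm ε).aestronglyMeasurable) ?_
    (Continuous.aestronglyMeasurable (by fun_prop)) ?_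
    (Continuous.intervalIntegrable (by fun_prop) _ _) ?_).2
  · simp only [zero_smul, add_zero]
    exact Continuous.intervalIntegrable (by fun_prop) _ _
  · refine .of_forall fun t _ => LipschitzOnWith.of_dist_le_mul fun x hx y hy => ?_
    have hnorm {z : ℝ} (hz : z ∈ Metric.ball (0 : ℝ) 1) : ‖q t + z • b j t‖ ≤ 3 * ‖q t‖ := by
      have hz1 : ‖z‖ ≤ 1 := (mem_ball_zero_iff.mp hz).le
      calc ‖q t + z • b j t‖ ≤ ‖q t‖ + ‖z‖ * ‖b j t‖ := by
            simpa [norm_smul] using norm_add_le (q t) (z • b j t)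
        _ ≤ ‖q t‖ + 1 * (2 * ‖q t‖) := by
            gcongr
            exact hbn t
        _ = 3 * ‖q t‖ := by ring
    have hdiff : ‖(q t + x • b j t) - (q t + y • b j t)‖ ≤ |x - y| * (2 * ‖q t‖) := by
      rw [add_sub_add_left_eq_sub, ← sub_smul, norm_smul, Real.norm_eq_abs]
      gcongr
      exact hbn t
    rw [Real.dist_eq, Real.dist_eq, Real.coe_nnabs,
      abs_of_nonneg (by positivity : 0 ≤ 12 * ‖q t‖ ^ 2)]
    refine (EuclideanSpace.abs_apply_mul_norm_sub_le _ _ i).trans ?_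
    calc _ ≤ (3 * ‖q t‖ + 3 * ‖q t‖) * (|x - y| * (2 * ‖q t‖)) :=
          mul_le_mul (add_le_add (hnorm hx) (hnorm hy)) hdiff (norm_nonneg _) (by positivity)
      _ = 12 * ‖q t‖ ^ 2 * |x - y| := by ring
  · refine .of_forall fun t ht => ?_
    rw [uIoc_of_le hT.le] at ht
    have hqt : q t ≠ 0 := hne t (Ioc_subset_Icc_self ht)
    have hqn : ‖q t‖ ≠ 0 := norm_ne_zero_iff.mpr hqt
    refine (EuclideanSpace.hasDerivAt_apply_mul_norm hqt (b j t) i).congr_deriv ?_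
    have hinner : inner ℝ (q t) (b j t) = 2 * q t j * ‖q t‖ := by
      rw [hb, inner_add_right, real_inner_smul_right, real_inner_smul_right,
        real_inner_self_eq_norm_sq, EuclideanSpace.inner_single_right]
      simp only [conj_trivial]
      field_simp
      ring
    have hbi : b j t i = q t j / ‖q t‖ * q t i + ‖q t‖ * (if i = j then (1:ℝ) else 0) := by
      simp [hb]
    rw [hinner, hbi]
    field_simp
    ring
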